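/- Let H = (V, E) be a finite hypergraph, let B be a finite set of orbits, and let c assign to every incidence pair (v, e) with v ∈ e ∈ E an orbit c(v, e) ∈ B. For any natural number k, if S and T are both role-aware k-quarks of H (with respect to c) and S ∩ T ≠ ∅, then S = T; that is, distinct role-aware k-quarks for the same k are node-disjoint. -/

import Mathlib

variable {V : Type*}

/-- Degree of node `v` in the hypergraph with hyperedge set `E` induced on `S`:
the number of hyperedges contained in `S` that contain `v`. -/
def hdeg [DecidableEq V] (E : Finset (Finset V)) (S : Finset V) (v : V) : ℕ :=
  (E.filter fun e => v ∈ e ∧ e ⊆ S).card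

/-- Nodes `u` and `v` are connected in the hypergraph induced on `S`:
there is a nonempty sequence of hyperedges of `H|_S` starting at an edge containing `u`,
ending at an edge containing `v`, with consecutive edges intersecting. -/
def HConn [DecidableEq V] (E : Finset (Finset V)) (S : Finset V) (u v : V) : Prop :=
  ∃ (l : List (Finset V)) (hl : l ≠ []),
    (∀ e ∈ l, e ∈ E ∧ e ⊆ S) ∧ u ∈ l.head hl ∧ v ∈ l.getLast hl ∧
    l.Chain' fun e f => (e ∩ f).Nonempty

/-- The hypergraph induced on `S` is connected. -/
def ConnectedOn [DecidableEq V] (E : Finset (Finset V)) (S : Finset V) : Prop :=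
  ∀ u ∈ S, ∀ v ∈ S, HConn E S u v

/-- `S` is a `k`-quark: the induced hypergraph is connected, has minimum degree at least `k`,
and `S` is maximal with these two properties. -/
def IsQuark [DecidableEq V] (E : Finset (Finset V)) (k : ℕ) (S : Finset V) : Prop :=
  ConnectedOn E S ∧ (∀ v ∈ S, k ≤ hdeg E S v) ∧
    ∀ T : Finset V, S ⊆ T → ConnectedOn E T → (∀ v ∈ T, k ≤ hdeg E T v) → T = S

/-- The quark number of `u`: the largest `k` such that `u` belongs to a nonempty `k`-quark. -/
noncomputable def quarkNum [DecidableEq V] (E : Finset (Finset V)) (u : V) : ℕ :=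
  sSup {k : ℕ | ∃ S : Finset V, IsQuark E k S ∧ u ∈ S}

/-- Orbit degree: the number of hyperedges of the hypergraph induced on `S` that contain `v`
and in which the orbit of `v` (given by `c`) is `o`. -/
def orbitDeg [DecidableEq V] {β : Type*} [DecidableEq β] (E : Finset (Finset V))
    (c : V → Finset V → β) (S : Finset V) (o : β) (v : V) : ℕ :=
  (E.filter fun e => v ∈ e ∧ e ⊆ S ∧ c v e = o).card

/-- `S` is a role-aware `k`-quark: the induced hypergraph is connected, every node has some
orbit in `B` with orbit degree at least `k`, and `S` is maximal with these two properties. -/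
def RAQuark [DecidableEq V] {β : Type*} [DecidableEq β] (E : Finset (Finset V))
    (B : Finset β) (c : V → Finset V → β) (k : ℕ) (S : Finset V) : Prop :=
  ConnectedOn E S ∧ (∀ v ∈ S, ∃ o ∈ B, k ≤ orbitDeg E c S o v) ∧
    ∀ T : Finset V, S ⊆ T → ConnectedOn E T →
      (∀ v ∈ T, ∃ o ∈ B, k ≤ orbitDeg E c T o v) → T = S

theorem HConn.mono [DecidableEq V] {E : Finset (Finset V)} {S T : Finset V} (hST : S ⊆ T)
    {u v : V} (h : HConn E S u v) : HConn E T u v := by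
  obtain ⟨l, hl, hE, hu, hv, hchain⟩ := h
  exact ⟨l, hl, fun e he => ⟨(hE e he).1, (hE e he).2.trans hST⟩, hu, hv, hchain⟩

theorem HConn.trans [DecidableEq V] {E : Finset (Finset V)} {S : Finset V} {u v w : V}
    (huv : HConn E S u v) (hvw : HConn E S v w) : HConn E S u w := by
  obtain ⟨l₁, hl₁, hE₁, hu, hv₁, hchain₁⟩ := huv
  obtain ⟨l₂, hl₂, hE₂, hv₂, hw, hchain₂⟩ := hvw
  refine ⟨l₁ ++ l₂, List.append_ne_nil_of_left_ne_nil hl₁ l₂, ?_, ?_, ?_, ?_⟩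
  · intro e he
    exact (List.mem_append.1 he).elim (hE₁ e) (hE₂ e)
  · rwa [List.head_append_of_ne_nil hl₁]
  · rwa [List.getLast_append_of_ne_nil _ hl₂]
  · refine List.isChain_append.2 ⟨hchain₁, hchain₂, fun e he f hf => ⟨v, ?_⟩⟩
    rw [List.getLast?_eq_some_getLast hl₁, Option.mem_some_iff] at he
    rw [List.head?_eq_some_head hl₂, Option.mem_some_iff] at hf
    subst he hf
    exact Finset.mem_inter.2 ⟨hv₁, hv₂⟩

theorem ConnectedOn.union [DecidableEq V] {E : Finset (Finset V)} {S T : Finset V}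
    (hS : ConnectedOn E S) (hT : ConnectedOn E T) (hST : (S ∩ T).Nonempty) :
    ConnectedOn E (S ∪ T) := by
  obtain ⟨w, hw⟩ := hST
  obtain ⟨hwS, hwT⟩ := Finset.mem_inter.1 hw
  intro u hu v hv
  have huw : HConn E (S ∪ T) u w := (Finset.mem_union.1 hu).elim
    (fun h => (hS u h w hwS).mono Finset.subset_union_left)
    (fun h => (hT u h w hwT).mono Finset.subset_union_right)
  have hwv : HConn E (S ∪ T) w v := (Finset.mem_union.1 hv).elim
    (fun h => (hS w hwS v h).mono Finset.subset_union_left)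
    (fun h => (hT w hwT v h).mono Finset.subset_union_right)
  exact huw.trans hwv

theorem orbitDeg_mono [DecidableEq V] {β : Type*} [DecidableEq β] (E : Finset (Finset V))
    (c : V → Finset V → β) {S T : Finset V} (hST : S ⊆ T) (o : β) (v : V) :
    orbitDeg E c S o v ≤ orbitDeg E c T o v :=
  Finset.card_le_card <| Finset.monotone_filter_right E
    fun _ _ h => ⟨h.1, h.2.1.trans hST, h.2.2⟩

/-- distinct role-aware `k`-quarks (same `k`) are node-disjoint. -/
theorem stmt_14 [Fintype V] [DecidableEq V] {β : Type*} [DecidableEq β]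
    (E : Finset (Finset V)) (B : Finset β) (c : V → Finset V → β)
    (hc : ∀ e ∈ E, ∀ v ∈ e, c v e ∈ B) (k : ℕ)
    (S T : Finset V) (hS : RAQuark E B c k S) (hT : RAQuark E B c k T)
    (hST : (S ∩ T).Nonempty) : S = T := by
  have hconn := hS.1.union hT.1 hST
  have horbit : ∀ v ∈ S ∪ T, ∃ o ∈ B, k ≤ orbitDeg E c (S ∪ T) o v := by
    intro v hv
    rcases Finset.mem_union.1 hv with h | h
    · obtain ⟨o, ho, hk⟩ := hS.2.1 v h
      exact ⟨o, ho, hk.trans (orbitDeg_mono E c Finset.subset_union_left o v)⟩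
    · obtain ⟨o, ho, hk⟩ := hT.2.1 v h
      exact ⟨o, ho, hk.trans (orbitDeg_mono E c Finset.subset_union_right o v)⟩
  exact (hS.2.2 _ Finset.subset_union_left hconn horbit).symm.trans
    (hT.2.2 _ Finset.subset_union_right hconn horbit)
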